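/- arXiv:2511.10019 — 2 statements merged into one kernel-verified Lean document; each statement's English description precedes it below -/
import Mathlib

section
/- Let A ∈ ℤ^{m×n} be a matrix with at most two nonzero entries per row, let k be the number of columns of A containing an entry outside {−1, 0, 1}, and let OCP(A) denote the odd cycle packing number of the signed graph whose signed edge-vertex incidence matrix is given by the signed support of A. If A is totally Δ-modular, then: (1) ‖A‖∞ ≤ Δ; (2) k ≤ 2·log₂ Δ; and (3) OCP(A) ≤ log₂ Δ. Conversely, if Δ is the largest absolute value of a subdeterminant of A, then Δ ≤ 2^{OCP(A)} · ‖A‖∞^k. -/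
/-- The rows `E` and columns `Vt` form an odd cycle of the signed graph whose
signed edge-vertex incidence matrix is the signed support of `A`: there are
`ℓ ≥ 2` distinct rows `e 0, …, e (ℓ-1)` and distinct columns `v 0, …, v (ℓ-1)`
such that the nonzero entries of row `e i` are exactly in columns `v i` and
`v (i+1)` (indices mod `ℓ`), and the number of rows whose two nonzero entries
have the same sign (the odd edges of the signed graph) is odd. -/
def IsMatrixOddCycle {m n : ℕ} (A : Matrix (Fin m) (Fin n) ℤ)
    (E : Finset (Fin m)) (Vt : Finset (Fin n)) : Prop :=
  ∃ (ℓ : ℕ) (e : Fin ℓ → Fin m) (v : Fin ℓ → Fin n),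
    2 ≤ ℓ ∧ Function.Injective e ∧ Function.Injective v ∧
    E = Finset.image e Finset.univ ∧ Vt = Finset.image v Finset.univ ∧
    (∀ (i : Fin ℓ) (j : Fin n), A (e i) j ≠ 0 ↔ (j = v i ∨ j = v (finRotate ℓ i))) ∧
    Odd (Finset.univ.filter
      (fun i : Fin ℓ => 0 < A (e i) (v i) * A (e i) (v (finRotate ℓ i)))).card

/-- The odd cycle packing number of the signed graph associated with the matrix
`A`: the maximum number of pairwise vertex-disjoint odd cycles. -/
noncomputable def matrixOCP {m n : ℕ} (A : Matrix (Fin m) (Fin n) ℤ) : ℕ :=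
  sSup {c | ∃ (E : Fin c → Finset (Fin m)) (Vt : Fin c → Finset (Fin n)),
    (∀ i, IsMatrixOddCycle A (E i) (Vt i)) ∧
    ∀ i j, i ≠ j → Disjoint (Vt i) (Vt j)}

/-- Every subdeterminant of `A` has absolute value at most `Δ`. -/
def TotallyDeltaModular {m n : ℕ} (A : Matrix (Fin m) (Fin n) ℤ) (Δ : ℕ) : Prop :=
  ∀ (r : ℕ) (re : Fin r → Fin m) (ce : Fin r → Fin n),
    Function.Injective re → Function.Injective ce →
    ((A.submatrix re ce).det).natAbs ≤ Δ

/-- The maximum absolute value `‖A‖_∞` of an entry of `A`. -/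
def maxEntry {m n : ℕ} (A : Matrix (Fin m) (Fin n) ℤ) : ℕ :=
  Finset.univ.sup fun p : Fin m × Fin n => (A p.1 p.2).natAbs

lemma cyc_perm {p : ℕ} (τ : Equiv.Perm (Fin (p + 2)))
    (h : ∀ i, τ i = i ∨ τ i = finRotate (p + 2) i) : τ = 1 ∨ τ = finRotate (p + 2) := by
  by_cases h1 : τ = 1
  · exact Or.inl h1
  right
  have hc := isCycle_finRotate (n := p)
  have hfix : ∀ i, finRotate (p + 2) i ≠ i := by
    intro i hi
    have := support_finRotate (n := p)
    have h2 : i ∈ (finRotate (p + 2)).support := by rw [this]; simp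
    exact (Equiv.Perm.mem_support.mp h2) hi
  obtain ⟨x, hx⟩ : ∃ x, τ x ≠ x := by
    by_contra hcon
    push Not at hcon
    exact h1 (Equiv.ext hcon)
  have hx' : τ x = finRotate (p + 2) x := (h x).resolve_left hx
  have hstep : ∀ n : ℕ, τ (((finRotate (p + 2)) ^ n) x) = finRotate (p + 2) (((finRotate (p + 2)) ^ n) x) := by
    intro n
    induction n with
    | zero => simpa using hx'
    | succ n ih =>
      rw [pow_succ', Equiv.Perm.mul_apply]
      refine (h _).resolve_left ?_
      intro hh
      rw [← ih] at hh
      have := τ.injective hh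
      rw [ih] at this
      exact hfix _ this
  ext1 y
  obtain ⟨n, hn⟩ := hc.exists_pow_eq (hfix x) (hfix y)
  rw [← hn]
  exact hstep n

lemma cyc_det {p : ℕ} (C : Matrix (Fin (p + 2)) (Fin (p + 2)) ℤ)
    (h : ∀ i j, C i j ≠ 0 → j = i ∨ j = finRotate (p + 2) i) :
    C.det = ∏ i, C i i + (-1) ^ (p + 1) * ∏ i, C i (finRotate (p + 2) i) := by
  rw [← Matrix.det_transpose, Matrix.det_apply]
  have hne : (1 : Equiv.Perm (Fin (p + 2))) ≠ finRotate (p + 2) := by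
    intro hh
    exact (isCycle_finRotate (n := p)).ne_one hh.symm
  rw [← Finset.sum_subset (Finset.subset_univ {1, finRotate (p + 2)}), Finset.sum_pair hne]
  · simp only [Matrix.transpose_apply, sign_finRotate, Equiv.Perm.sign_one]
    simp [Units.smul_def]
  · intro τ _ hτ
    have : ∃ i, C i (τ i) = 0 := by
      by_contra hcon
      push Not at hcon
      apply hτ
      simp only [Finset.mem_insert, Finset.mem_singleton]
      exact cyc_perm τ fun i => h _ _ (hcon i)
    obtain ⟨i, hi⟩ := this
    rw [Finset.prod_eq_zero (Finset.mem_univ i) (by simpa using hi), smul_zero]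

lemma sign_prod {ι : Type*} [Fintype ι] (c : ι → ℤ) (hc : ∀ i, c i ≠ 0) :
    0 < (-1) ^ (Finset.univ.filter fun i => ¬ 0 < c i).card * ∏ i, c i := by
  have : ((-1 : ℤ)) ^ (Finset.univ.filter fun i => ¬ 0 < c i).card =
      ∏ i, if 0 < c i then (1 : ℤ) else -1 := by
    rw [Finset.prod_ite]; simp
  rw [this, ← Finset.prod_mul_distrib]
  refine Finset.prod_pos fun i _ => ?_
  have := hc i
  split_ifs <;> omega

lemma cyc_sign {p : ℕ} (a b : Fin (p + 2) → ℤ) (ha : ∀ i, a i ≠ 0) (hb : ∀ i, b i ≠ 0) :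
    (Odd (Finset.univ.filter fun i => 0 < a i * b i).card →
      0 < (∏ i, a i) * ((-1) ^ (p + 1) * ∏ i, b i)) ∧
    (¬ Odd (Finset.univ.filter fun i => 0 < a i * b i).card →
      (∏ i, a i) * ((-1) ^ (p + 1) * ∏ i, b i) < 0) := by
  have h1 := sign_prod (fun i => a i * b i) (fun i => mul_ne_zero (ha i) (hb i))
  have h2 := Finset.card_filter_add_card_filter_not (s := (Finset.univ : Finset (Fin (p+2))))
    (fun i => 0 < a i * b i)
  rw [Finset.prod_mul_distrib] at h1
  simp only [Finset.card_univ, Fintype.card_fin] at h2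
  set N := (Finset.univ.filter fun i => 0 < a i * b i).card
  set N' := (Finset.univ.filter fun i => ¬ 0 < a i * b i).card
  constructor
  · intro ho
    have : ((-1 : ℤ)) ^ (p + 1) = (-1) ^ N' := by
      rw [neg_one_pow_eq_pow_mod_two, neg_one_pow_eq_pow_mod_two (n := N')]
      congr 1
      rw [Nat.odd_iff] at ho
      omega
    rw [this]; linarith
  · intro ho
    have : ((-1 : ℤ)) ^ (p + 1) = - (-1) ^ N' := by
      have : ((-1 : ℤ)) ^ (p + 2) = (-1) ^ N' := by
        rw [neg_one_pow_eq_pow_mod_two, neg_one_pow_eq_pow_mod_two (n := N')]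
        congr 1
        rw [Nat.odd_iff] at ho
        omega
      rw [← this]; ring
    rw [this]; linarith

lemma two_le_add {x y : ℤ} (h : 0 < x * y) : 2 ≤ (x + y).natAbs := by
  rcases pos_and_pos_or_neg_and_neg_of_mul_pos h with h | h <;> omega

lemma add_le_max {x y : ℤ} {W : ℕ} (h : x * y < 0) (hx : x.natAbs ≤ W) (hy : y.natAbs ≤ W) :
    (x + y).natAbs ≤ W := by
  rcases mul_neg_iff.mp h with h | h <;> omega

lemma cyc_two_le {p : ℕ} (C : Matrix (Fin (p + 2)) (Fin (p + 2)) ℤ)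
    (h : ∀ i j, C i j ≠ 0 ↔ j = i ∨ j = finRotate (p + 2) i)
    (ho : Odd (Finset.univ.filter fun i => 0 < C i i * C i (finRotate (p + 2) i)).card) :
    2 ≤ C.det.natAbs := by
  rw [cyc_det C fun i j => (h i j).mp]
  exact two_le_add ((cyc_sign (fun i => C i i) (fun i => C i (finRotate (p + 2) i))
    (fun i => (h _ _).mpr (Or.inl rfl)) (fun i => (h _ _).mpr (Or.inr rfl))).1 ho)

lemma cyc_le {p : ℕ} (C : Matrix (Fin (p + 2)) (Fin (p + 2)) ℤ)
    (h : ∀ i j, C i j ≠ 0 ↔ j = i ∨ j = finRotate (p + 2) i)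
    (w : Fin (p + 2) → ℕ) (hw : ∀ i j, (C i j).natAbs ≤ w j) :
    C.det.natAbs ≤ 2 * ∏ i, w i ∧
    (¬ Odd (Finset.univ.filter fun i => 0 < C i i * C i (finRotate (p + 2) i)).card →
      C.det.natAbs ≤ ∏ i, w i) := by
  rw [cyc_det C fun i j => (h i j).mp]
  have hA : (∏ i, C i i).natAbs ≤ ∏ i, w i := by
    rw [← Int.natAbsHom_apply, map_prod]
    exact Finset.prod_le_prod' fun i _ => hw i i
  have hB : ((-1) ^ (p + 1) * ∏ i, C i (finRotate (p + 2) i)).natAbs ≤ ∏ i, w i := by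
    rw [Int.natAbs_mul, Int.natAbs_pow, ← Equiv.prod_comp (finRotate (p + 2)) w]
    simp only [Int.reduceNeg, Int.natAbs_neg, Int.natAbs_one, one_pow, one_mul]
    rw [← Int.natAbsHom_apply, map_prod]
    exact Finset.prod_le_prod' fun i _ => hw i _
  refine ⟨by omega, fun ho => add_le_max ?_ hA hB⟩
  exact ((cyc_sign (fun i => C i i) (fun i => C i (finRotate (p + 2) i))
    (fun i => (h _ _).mpr (Or.inl rfl)) (fun i => (h _ _).mpr (Or.inr rfl))).2 ho)

/-- Total modularity applied to arbitrary finite index types. -/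
lemma tdm_apply {m n : ℕ} {A : Matrix (Fin m) (Fin n) ℤ} {Δ : ℕ} (h : TotallyDeltaModular A Δ)
    {ι : Type*} [Fintype ι] [DecidableEq ι] (re : ι → Fin m) (ce : ι → Fin n)
    (hre : Function.Injective re) (hce : Function.Injective ce) :
    ((A.submatrix re ce).det).natAbs ≤ Δ := by
  have e := (Fintype.equivFin ι).symm
  have := h _ (re ∘ e) (ce ∘ e) (hre.comp e.injective) (hce.comp e.injective)
  rwa [← Matrix.submatrix_submatrix, Matrix.det_submatrix_equiv_self] at this

lemma inj_of_det {m n : ℕ} {A : Matrix (Fin m) (Fin n) ℤ}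
    {ι : Type*} [Fintype ι] [DecidableEq ι] (re : ι → Fin m) (ce : ι → Fin n)
    (h : (A.submatrix re ce).det ≠ 0) : Function.Injective re := by
  intro i j hij
  by_contra hne
  exact h (Matrix.det_zero_of_row_eq hne (by ext x; simp [hij]))

lemma tri_bound {m n : ℕ} {A : Matrix (Fin m) (Fin n) ℤ} {Δ : ℕ} (h : TotallyDeltaModular A Δ)
    (S : Finset (Fin n)) (r : Fin n → Fin m) (hr : ∀ j ∈ S, 1 < (A (r j) j).natAbs)
    (htri : (∀ j ∈ S, ∀ j' ∈ S, j' < j → A (r j) j' = 0) ∨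
      (∀ j ∈ S, ∀ j' ∈ S, j < j' → A (r j) j' = 0)) : 2 ^ S.card ≤ Δ := by
  let M := A.submatrix (fun j : S => r j) (fun j : S => (j : Fin n))
  have hdet : M.det = ∏ j : S, A (r j) j := by
    rcases htri with ht | ht
    · rw [Matrix.det_of_isUpperTriangular (M := M)]
      · rfl
      · intro i j hij
        exact ht i i.2 j j.2 hij
    · rw [Matrix.det_of_isLowerTriangular (M := M)]
      · rfl
      · intro i j hij
        exact ht i i.2 j j.2 hij
  have h2 : 2 ^ S.card ≤ M.det.natAbs := by
    rw [hdet, ← Int.natAbsHom_apply, map_prod]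
    calc 2 ^ S.card = ∏ j : S, 2 := by simp
      _ ≤ _ := Finset.prod_le_prod' fun j _ => hr j j.2
  have h3 : M.det ≠ 0 := by
    intro h0
    rw [h0] at h2
    simp at h2
  exact h2.trans (tdm_apply h _ _ (inj_of_det _ _ h3) Subtype.val_injective)

lemma part_two {m n : ℕ} {A : Matrix (Fin m) (Fin n) ℤ} {Δ : ℕ}
    (hrow : ∀ i : Fin m, (Finset.univ.filter fun j : Fin n => A i j ≠ 0).card ≤ 2)
    (h : TotallyDeltaModular A Δ) :
    2 ^ (Finset.univ.filter fun j : Fin n => ∃ i : Fin m, 1 < (A i j).natAbs).card ≤ Δ ^ 2 := by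
  classical
  set K := Finset.univ.filter fun j : Fin n => ∃ i : Fin m, 1 < (A i j).natAbs with hK
  rcases K.eq_empty_or_nonempty with hE | ⟨j₀, hj₀⟩
  · have := h 0 (fun i => i.elim0) (fun i => i.elim0) (fun i => i.elim0) (fun i => i.elim0)
    simp only [Matrix.det_isEmpty, Int.natAbs_one] at this
    rw [hE, Finset.card_empty, pow_zero]
    exact Nat.one_le_pow _ _ this
  obtain ⟨i₀, _⟩ := (Finset.mem_filter.mp hj₀).2
  have hex : ∀ j : Fin n, ∃ i, j ∈ K → 1 < (A i j).natAbs := by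
    intro j
    by_cases hj : j ∈ K
    · obtain ⟨i, hi⟩ := (Finset.mem_filter.mp hj).2
      exact ⟨i, fun _ => hi⟩
    · exact ⟨i₀, fun hj' => absurd hj' hj⟩
  choose r hr using hex
  set S := K.filter fun j => ∀ j' ∈ K, j' < j → A (r j) j' = 0 with hS
  set T := K.filter fun j => ∀ j' ∈ K, j < j' → A (r j) j' = 0 with hT
  have hSK : ∀ j ∈ S, j ∈ K := fun j hj => (Finset.mem_filter.mp hj).1
  have hTK : ∀ j ∈ T, j ∈ K := fun j hj => (Finset.mem_filter.mp hj).1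
  have hbS : 2 ^ S.card ≤ Δ := tri_bound h S r (fun j hj => hr j (hSK j hj))
    (Or.inl fun j hj j' hj' => (Finset.mem_filter.mp hj).2 j' (hSK j' hj'))
  have hbT : 2 ^ T.card ≤ Δ := tri_bound h T r (fun j hj => hr j (hTK j hj))
    (Or.inr fun j hj j' hj' => (Finset.mem_filter.mp hj).2 j' (hTK j' hj'))
  have hcov : K ⊆ S ∪ T := by
    intro j hj
    by_contra hcon
    rw [Finset.mem_union, not_or] at hcon
    obtain ⟨h1, h2⟩ := hcon
    have h1 := fun hcon => h1 (Finset.mem_filter.mpr ⟨hj, hcon⟩)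
    have h2 := fun hcon => h2 (Finset.mem_filter.mpr ⟨hj, hcon⟩)
    rw [imp_false] at h1 h2
    push Not at h1 h2
    obtain ⟨a, -, ha, ha0⟩ := h1
    obtain ⟨b, -, hb, hb0⟩ := h2
    have hj0 : A (r j) j ≠ 0 := by
      intro h0
      have := hr j hj
      rw [h0] at this
      simp at this
    have hsub : ({a, j, b} : Finset (Fin n)) ⊆ Finset.univ.filter fun x => A (r j) x ≠ 0 := by
      intro x hx
      simp only [Finset.mem_insert, Finset.mem_singleton] at hx
      rcases hx with rfl | rfl | rfl <;> simp [*]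
    have hc := (Finset.card_le_card hsub).trans (hrow (r j))
    rw [Finset.card_eq_three.mpr ⟨a, j, b, ha.ne, (ha.trans hb).ne, hb.ne, rfl⟩] at hc
    omega
  calc 2 ^ K.card ≤ 2 ^ (S.card + T.card) :=
        Nat.pow_le_pow_right (by norm_num)
          ((Finset.card_le_card hcov).trans (Finset.card_union_le _ _))
    _ = 2 ^ S.card * 2 ^ T.card := pow_add _ _ _
    _ ≤ Δ * Δ := Nat.mul_le_mul hbS hbT
    _ = Δ ^ 2 := (sq Δ).symm

lemma oddCycle_nonempty {m n : ℕ} {A : Matrix (Fin m) (Fin n) ℤ} {E : Finset (Fin m)}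
    {V : Finset (Fin n)} (h : IsMatrixOddCycle A E V) : V.Nonempty := by
  obtain ⟨l, e, v, hl, -, -, -, rfl, -⟩ := h
  exact ⟨v ⟨0, by omega⟩, Finset.mem_image_of_mem _ (Finset.mem_univ _)⟩

lemma ocp_bdd {m n : ℕ} (A : Matrix (Fin m) (Fin n) ℤ) :
    BddAbove {c | ∃ (E : Fin c → Finset (Fin m)) (Vt : Fin c → Finset (Fin n)),
    (∀ i, IsMatrixOddCycle A (E i) (Vt i)) ∧
    ∀ i j, i ≠ j → Disjoint (Vt i) (Vt j)} := by
  refine ⟨n, ?_⟩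
  rintro c ⟨E, V, hcyc, hdis⟩
  choose f hf using fun i => oddCycle_nonempty (hcyc i)
  have hinj : Function.Injective f := by
    intro i j hij
    by_contra hne
    exact Finset.disjoint_left.mp (hdis i j hne) (hf i) (hij ▸ hf j)
  simpa using Fintype.card_le_of_injective f hinj

lemma part_three {m n : ℕ} {A : Matrix (Fin m) (Fin n) ℤ} {Δ : ℕ}
    (h : TotallyDeltaModular A Δ) : 2 ^ matrixOCP A ≤ Δ := by
  classical
  have hmem := Nat.sSup_mem (s := {c | ∃ (E : Fin c → Finset (Fin m)) (Vt : Fin c → Finset (Fin n)),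
    (∀ i, IsMatrixOddCycle A (E i) (Vt i)) ∧ ∀ i j, i ≠ j → Disjoint (Vt i) (Vt j)})
    ⟨0, fun i => i.elim0, fun i => i.elim0, fun i => i.elim0, fun i => i.elim0⟩ (ocp_bdd A)
  change matrixOCP A ∈ _ at hmem
  generalize matrixOCP A = c at hmem
  obtain ⟨E, V, hcyc, hdis⟩ := hmem
  choose l e v hl he hv hE hV hsupp hodd using hcyc
  have hvV : ∀ i a, v i a ∈ V i := by
    intro i a
    rw [hV]
    exact Finset.mem_image_of_mem _ (Finset.mem_univ _)
  have hvinj : Function.Injective fun x : (Σ i : Fin c, Fin (l i)) => v x.1 x.2 := by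
    rintro ⟨i, a⟩ ⟨j, b⟩ hij
    by_cases hne : i = j
    · subst hne
      simp only at hij
      rw [hv i hij]
    · have hij' : v i a = v j b := hij
      exact absurd (hij' ▸ hvV j b) (Finset.disjoint_left.mp (hdis i j hne) (hvV i a))
  let M := A.submatrix (fun x : (Σ i : Fin c, Fin (l i)) => e x.1 x.2)
    (fun x : (Σ i : Fin c, Fin (l i)) => v x.1 x.2)
  have htri : M.BlockTriangular Sigma.fst := by
    rintro ⟨i, a⟩ ⟨j, b⟩ hij
    by_contra h0
    have hne : j ≠ i := ne_of_lt hij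
    rcases (hsupp i a (v j b)).mp h0 with h1 | h1
    · exact Finset.disjoint_left.mp (hdis j i hne) (hvV j b) (h1 ▸ hvV i _)
    · exact Finset.disjoint_left.mp (hdis j i hne) (hvV j b) (h1 ▸ hvV i _)
  have hblock : ∀ i, 2 ≤ (M.toSquareBlock Sigma.fst i).det.natAbs := by
    intro i
    rw [← Matrix.det_submatrix_equiv_self (Equiv.sigmaSubtype i).symm]
    change 2 ≤ (A.submatrix (e i) (v i)).det.natAbs
    have hl' := hl i
    have hs' := hsupp i
    have ho' := hodd i
    have hv' := hv i
    generalize e i = e' at *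
    generalize v i = v' at *
    generalize l i = l' at *
    obtain ⟨p, rfl⟩ : ∃ p, l' = p + 2 := ⟨l' - 2, by omega⟩
    apply cyc_two_le
    · intro a b
      rw [Matrix.submatrix_apply, hs', hv'.eq_iff, hv'.eq_iff]
    · exact ho'
  have hbd : 2 ^ c ≤ M.det.natAbs := by
    rw [htri.det_fintype, ← Int.natAbsHom_apply, map_prod]
    calc 2 ^ c = ∏ j : Fin c, 2 := by simp
      _ ≤ _ := Finset.prod_le_prod' fun j _ => hblock j
  have h3 : M.det ≠ 0 := by
    intro h0
    rw [h0] at hbd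
    simp at hbd
  exact hbd.trans (tdm_apply h _ _ (inj_of_det _ _ h3) hvinj)

lemma exists_cycle {ι : Type*} [Finite ι] [Nonempty ι] (f : ι → ι) :
    ∃ (l : ℕ) (v : Fin (l + 1) → ι), Function.Injective v ∧
      ∀ i, f (v i) = v (finRotate (l + 1) i) := by
  obtain ⟨x0⟩ := ‹Nonempty ι›
  obtain ⟨x, hx⟩ : ∃ x, x ∈ Function.periodicPts f := by
    obtain ⟨a, b, hab, heq⟩ := Finite.exists_ne_map_eq_of_infinite (fun n : ℕ => f^[n] x0)
    have key : ∀ a b : ℕ, a < b → f^[a] x0 = f^[b] x0 → f^[a] x0 ∈ Function.periodicPts f := by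
      intro a b hlt heq
      refine Function.mk_mem_periodicPts (n := b - a) (by omega) ?_
      rw [Function.IsPeriodicPt, Function.IsFixedPt, ← Function.iterate_add_apply,
        Nat.sub_add_cancel hlt.le, heq]
    rcases lt_or_gt_of_ne hab with hlt | hlt
    · exact ⟨_, key a b hlt heq⟩
    · exact ⟨_, key b a hlt heq.symm⟩
  have hpos := Function.minimalPeriod_pos_of_mem_periodicPts hx
  have hper := Function.iterate_minimalPeriod (f := f) (x := x)
  have hinj := Function.iterate_injOn_Iio_minimalPeriod (f := f) (x := x)
  obtain ⟨l, hl⟩ : ∃ l, Function.minimalPeriod f x = l + 1 :=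
    ⟨Function.minimalPeriod f x - 1, by omega⟩
  rw [hl] at hper hinj
  refine ⟨l, fun i => f^[(i : ℕ)] x, ?_, ?_⟩
  · intro i j hij
    exact Fin.ext (hinj i.2 j.2 hij)
  · intro i
    change f (f^[(i : ℕ)] x) = f^[((finRotate (l + 1) i : Fin (l + 1)) : ℕ)] x
    rw [← Function.iterate_succ_apply' f, coe_finRotate]
    split_ifs with hi
    · rw [hi]
      exact hper
    · rfl

lemma main_bound {m n : ℕ} (A : Matrix (Fin m) (Fin n) ℤ)
    (hrow : ∀ i : Fin m, (Finset.univ.filter fun j : Fin n => A i j ≠ 0).card ≤ 2)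
    (w : Fin n → ℕ) (hw : ∀ i j, (A i j).natAbs ≤ w j) (N : ℕ) :
    ∀ (ι : Type) [Fintype ι] [DecidableEq ι] (re : ι → Fin m) (ce : ι → Fin n),
      Function.Injective ce → Fintype.card ι = N →
      ∃ P : Finset (Finset (Fin n)),
        (∀ V ∈ P, (∃ E, IsMatrixOddCycle A E V) ∧ ∀ x ∈ V, x ∈ Set.range ce) ∧
        (∀ V ∈ P, ∀ W ∈ P, V ≠ W → Disjoint V W) ∧
        (A.submatrix re ce).det.natAbs ≤ 2 ^ P.card * ∏ j, w (ce j) := by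
  classical
  induction N using Nat.strong_induction_on with
  | _ N IH =>
  intro ι _ _ re ce hce hN
  by_cases hdet : (A.submatrix re ce).det = 0
  · exact ⟨∅, by simp, by simp, by simp [hdet]⟩
  have hre := inj_of_det re ce hdet
  obtain ⟨π, hπ⟩ : ∃ π : Equiv.Perm ι, ∀ i, A (re i) (ce (π i)) ≠ 0 := by
    by_contra hcon
    push Not at hcon
    apply hdet
    rw [← Matrix.det_transpose, Matrix.det_apply]
    refine Finset.sum_eq_zero fun τ _ => ?_
    obtain ⟨i, hi⟩ := hcon τ
    rw [Finset.prod_eq_zero (Finset.mem_univ i) (by simpa using hi), smul_zero]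
  obtain ⟨c, hc⟩ : ∃ c : ι → Fin n, c = fun i => ce (π i) := ⟨_, rfl⟩
  have hcinj : Function.Injective c := by rw [hc]; exact hce.comp π.injective
  have hrange : Set.range ce = Set.range c := by
    rw [hc]; exact (π.surjective.range_comp ce).symm
  have hprod : ∏ j, w (ce j) = ∏ j, w (c j) := by
    rw [hc]; exact (Equiv.prod_comp π fun j => w (ce j)).symm
  have hdetc : (A.submatrix re ce).det.natAbs = (A.submatrix re c).det.natAbs := by
    have : A.submatrix re c = (A.submatrix re ce).submatrix id π := by rw [hc]; rfl
    rw [this, Matrix.det_permute', Int.natAbs_mul]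
    simp
  rw [hrange, hprod, hdetc]
  replace hπ : ∀ i, A (re i) (c i) ≠ 0 := by rw [hc]; exact hπ
  clear hc hrange hprod hdetc hdet hce
  rcases isEmpty_or_nonempty ι with hemp | hne
  · exact ⟨∅, by simp, by simp, by simp⟩
  have hthree : ∀ i x y z, x ≠ y → x ≠ z → y ≠ z → A i x ≠ 0 → A i y ≠ 0 → A i z ≠ 0 → False := by
    intro i x y z hxy hxz hyz hx hy hz
    have hsub : ({x, y, z} : Finset (Fin n)) ⊆ Finset.univ.filter fun x => A i x ≠ 0 := by
      intro t ht
      simp only [Finset.mem_insert, Finset.mem_singleton] at ht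
      rcases ht with rfl | rfl | rfl <;> simp [*]
    have hc := (Finset.card_le_card hsub).trans (hrow i)
    rw [Finset.card_eq_three.mpr ⟨x, y, z, hxy, hxz, hyz, rfl⟩] at hc
    omega
  have hex : ∀ i, ∃ j, (∀ j', A (re i) (c j') ≠ 0 → j' = i ∨ j' = j) ∧
      (j ≠ i → A (re i) (c j) ≠ 0) := by
    intro i
    by_cases hj : ∃ j, j ≠ i ∧ A (re i) (c j) ≠ 0
    · obtain ⟨j, hji, hj⟩ := hj
      refine ⟨j, fun j' hj' => ?_, fun _ => hj⟩
      by_contra hcon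
      rw [not_or] at hcon
      exact hthree (re i) (c i) (c j) (c j') (hcinj.ne hji.symm) (hcinj.ne (Ne.symm hcon.1))
        (hcinj.ne (Ne.symm hcon.2)) (hπ i) hj hj'
    · push Not at hj
      refine ⟨i, fun j' hj' => ?_, fun h => absurd rfl h⟩
      by_contra hcon
      exact hj' (hj j' (by tauto))
  choose o ho1 ho2 using hex
  obtain ⟨l, v, hv, hov⟩ := exists_cycle o
  obtain ⟨p, hp⟩ : ∃ p : ι → Prop, ∀ i, p i ↔ i ∈ Set.range v := ⟨_, fun i => Iff.rfl⟩
  have hsplit := Matrix.twoBlockTriangular_det' (A.submatrix re c) p (by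
    intro i hi j hj
    obtain ⟨i, rfl⟩ := (hp i).mp hi
    rw [hp] at hj
    by_contra h0
    rcases ho1 _ _ h0 with h1 | h1
    · exact hj ⟨i, h1.symm⟩
    · exact hj ⟨finRotate _ i, by rw [h1, hov]⟩)
  let eqv : Fin (l + 1) ≃ {i // p i} :=
    (Equiv.ofInjective v hv).trans (Equiv.subtypeEquivRight fun i => (hp i).symm)
  have hblock : ((A.submatrix re c).toSquareBlockProp p).det =
      (A.submatrix (re ∘ v) (c ∘ v)).det := by
    rw [← Matrix.det_submatrix_equiv_self eqv]
    rfl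
  have hrest : ((A.submatrix re c).toSquareBlockProp (fun i => ¬ p i)) =
      A.submatrix (fun i : {i // ¬ p i} => re i) (fun i : {i // ¬ p i} => c i) := rfl
  have hprod : ∏ j, w (c j) = (∏ i, w (c (v i))) *
      ∏ i : {i // ¬ p i}, w (c i) := by
    rw [← Fintype.prod_subtype_mul_prod_subtype p (fun j => w (c j))]
    congr 1
    exact (Equiv.prod_comp eqv (fun j => w (c j))).symm
  have hcard : Fintype.card {i // ¬ p i} < N := by
    rw [← hN]
    exact Fintype.card_subtype_lt (x := v 0) (fun h => h ((hp _).mpr ⟨0, rfl⟩))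
  obtain ⟨P, hP1, hP2, hP3⟩ := IH _ hcard {i // ¬ p i} (fun i => re i) (fun i => c i)
    (hcinj.comp Subtype.val_injective) rfl
  rw [hsplit, hblock, hrest, hprod, Int.natAbs_mul]
  have hmain : (A.submatrix (re ∘ v) (c ∘ v)).det.natAbs ≤ ∏ i, w (c (v i)) ∨
      ((∃ E, IsMatrixOddCycle A E (Finset.univ.image (c ∘ v))) ∧
        (A.submatrix (re ∘ v) (c ∘ v)).det.natAbs ≤ 2 * ∏ i, w (c (v i))) := by
    clear hsplit hblock hrest hprod hcard hP1 hP2 hP3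
    rcases l with _ | p
    · left
      simp [Matrix.det_unique, hw]
    · have hfix : ∀ i, finRotate (p + 2) i ≠ i := by
        intro i hi
        have h2 : i ∈ (finRotate (p + 2)).support := by rw [support_finRotate]; simp
        exact (Equiv.Perm.mem_support.mp h2) hi
      have hnz : ∀ i, A (re (v i)) (c (v (finRotate (p + 2) i))) ≠ 0 := by
        intro i
        have := ho2 (v i)
        rw [hov] at this
        exact this (hv.ne (hfix i))
      have hsup : ∀ i j, A.submatrix (re ∘ v) (c ∘ v) i j ≠ 0 ↔ j = i ∨ j = finRotate (p + 2) i := by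
        intro i j
        constructor
        · intro h
          rcases ho1 _ _ h with h1 | h1
          · exact Or.inl (hv h1)
          · rw [hov] at h1
            exact Or.inr (hv h1)
        · rintro (rfl | rfl)
          · exact hπ _
          · exact hnz _
      obtain ⟨hb1, hb2⟩ := cyc_le _ hsup (fun i => w (c (v i))) (fun i j => hw _ _)
      by_cases hodd : Odd (Finset.univ.filter fun i =>
          0 < A.submatrix (re ∘ v) (c ∘ v) i i *
            A.submatrix (re ∘ v) (c ∘ v) i (finRotate (p + 2) i)).card
      · right
        refine ⟨⟨Finset.univ.image (re ∘ v), p + 2, re ∘ v, c ∘ v, by omega, hre.comp hv,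
          hcinj.comp hv, rfl, rfl, ?_, hodd⟩, hb1⟩
        intro i j
        constructor
        · intro h
          by_contra hcon
          rw [not_or] at hcon
          exact hthree _ (c (v i)) (c (v (finRotate (p + 2) i))) j
            (hcinj.ne (hv.ne (hfix i).symm)) (Ne.symm hcon.1) (Ne.symm hcon.2)
            (hπ _) (hnz i) h
        · rintro (rfl | rfl)
          · exact hπ _
          · exact hnz _
      · exact Or.inl (hb2 hodd)
  rcases hmain with hb | ⟨⟨E, hE⟩, hb⟩
  · refine ⟨P, fun V hV => ⟨(hP1 V hV).1, fun x hx => ?_⟩, hP2, ?_⟩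
    · obtain ⟨i, rfl⟩ := (hP1 V hV).2 x hx
      exact ⟨i, rfl⟩
    · calc _ ≤ _ := Nat.mul_le_mul hb hP3
        _ = _ := by ring
  · have hdisj : ∀ V ∈ P, Disjoint (Finset.univ.image (c ∘ v)) V := by
      intro V hV
      rw [Finset.disjoint_left]
      intro x hx hxV
      obtain ⟨⟨i, hi⟩, rfl⟩ := (hP1 V hV).2 x hxV
      obtain ⟨a, -, ha⟩ := Finset.mem_image.mp hx
      exact hi ((hp i).mpr ⟨a, hcinj ha⟩)
    have hnot : Finset.univ.image (c ∘ v) ∉ P := by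
      intro hmem
      have := hdisj _ hmem
      rw [disjoint_self] at this
      exact (oddCycle_nonempty hE).ne_empty this
    refine ⟨insert (Finset.univ.image (c ∘ v)) P, ?_, ?_, ?_⟩
    · intro V hV
      rcases Finset.mem_insert.mp hV with rfl | hV
      · refine ⟨⟨E, hE⟩, fun x hx => ?_⟩
        obtain ⟨a, -, rfl⟩ := Finset.mem_image.mp hx
        exact ⟨v a, rfl⟩
      · refine ⟨(hP1 V hV).1, fun x hx => ?_⟩
        obtain ⟨i, rfl⟩ := (hP1 V hV).2 x hx
        exact ⟨i, rfl⟩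
    · intro V hV W hW hne
      rcases Finset.mem_insert.mp hV with rfl | hV <;> rcases Finset.mem_insert.mp hW with rfl | hW
      · exact absurd rfl hne
      · exact hdisj W hW
      · exact (hdisj V hV).symm
      · exact hP2 V hV W hW hne
    · rw [Finset.card_insert_of_notMem hnot]
      calc _ ≤ _ := Nat.mul_le_mul hb hP3
        _ = _ := by ring

lemma part_four {m n : ℕ} (A : Matrix (Fin m) (Fin n) ℤ)
    (hrow : ∀ i : Fin m, (Finset.univ.filter fun j : Fin n => A i j ≠ 0).card ≤ 2)
    (r : ℕ) (re : Fin r → Fin m) (ce : Fin r → Fin n) (hce : Function.Injective ce) :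
    (A.submatrix re ce).det.natAbs ≤ 2 ^ matrixOCP A * maxEntry A ^
      (Finset.univ.filter fun j : Fin n => ∃ i : Fin m, 1 < (A i j).natAbs).card := by
  classical
  have hmax : ∀ i j, (A i j).natAbs ≤ maxEntry A := fun i j =>
    Finset.le_sup (f := fun p : Fin m × Fin n => (A p.1 p.2).natAbs) (Finset.mem_univ (i, j))
  let w : Fin n → ℕ := fun j => if ∃ i : Fin m, 1 < (A i j).natAbs then maxEntry A else 1
  have hw : ∀ i j, (A i j).natAbs ≤ w j := by
    intro i j
    by_cases h : ∃ i : Fin m, 1 < (A i j).natAbs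
    · simp only [w, if_pos h]
      exact hmax i j
    · simp only [w, if_neg h]
      push Not at h
      exact h i
  have hw1 : ∀ j, 1 ≤ w j := by
    intro j
    by_cases h : ∃ i : Fin m, 1 < (A i j).natAbs
    · simp only [w, if_pos h]
      obtain ⟨i, hi⟩ := h
      exact hi.le.trans (hmax i j)
    · simp only [w, if_neg h]
      exact le_rfl
  obtain ⟨P, hP1, hP2, hP3⟩ := main_bound A hrow w hw r (Fin r) re ce hce (by simp)
  have hocp : P.card ≤ matrixOCP A := by
    apply le_csSup (ocp_bdd A)
    choose E hE using fun V : P => (hP1 V V.2).1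
    let f := P.equivFin.symm
    refine ⟨fun i => E (f i), fun i => (f i : Finset (Fin n)), fun i => hE _, fun i j hij => ?_⟩
    exact hP2 _ (f i).2 _ (f j).2 fun h => hij (f.injective (Subtype.ext h))
  have hprod : ∏ j, w (ce j) ≤ maxEntry A ^
      (Finset.univ.filter fun j : Fin n => ∃ i : Fin m, 1 < (A i j).natAbs).card := by
    calc ∏ j, w (ce j) = ∏ j ∈ Finset.univ.image ce, w j := by
          rw [Finset.prod_image hce.injOn]
      _ ≤ ∏ j, w j := Finset.prod_le_prod_of_subset_of_one_le' (Finset.subset_univ _)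
          fun j _ _ => hw1 j
      _ = _ := by simp [w, Finset.prod_ite]
  exact hP3.trans (Nat.mul_le_mul (Nat.pow_le_pow_right (by norm_num) hocp) hprod)

/-- Let `A` be an integer matrix with at most two nonzero
entries per row, let `k` be the number of columns of `A` containing an entry
outside `{-1, 0, 1}`, and let `Δ ≥ 1`.  If `A` is totally `Δ`-modular then
(1) `‖A‖_∞ ≤ Δ`, (2) `k ≤ 2·log₂ Δ` (stated exactly as `2 ^ k ≤ Δ ^ 2`), and
(3) `OCP(A) ≤ log₂ Δ` (stated exactly as `2 ^ OCP(A) ≤ Δ`).  Conversely, if `Δ`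
is the largest absolute value of a subdeterminant of `A`, then
`Δ ≤ 2 ^ OCP(A) · ‖A‖_∞ ^ k`. -/
theorem deltaModular_equivalence (m n : ℕ) (A : Matrix (Fin m) (Fin n) ℤ)
    (hrow : ∀ i : Fin m, (Finset.univ.filter fun j : Fin n => A i j ≠ 0).card ≤ 2)
    (k : ℕ) (hk : k = (Finset.univ.filter
      fun j : Fin n => ∃ i : Fin m, 1 < (A i j).natAbs).card)
    (Δ : ℕ) (hΔ : 1 ≤ Δ) :
    (TotallyDeltaModular A Δ →
      (∀ i j, (A i j).natAbs ≤ Δ) ∧ 2 ^ k ≤ Δ ^ 2 ∧ 2 ^ matrixOCP A ≤ Δ) ∧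
    ((TotallyDeltaModular A Δ ∧ ∃ (r : ℕ) (re : Fin r → Fin m) (ce : Fin r → Fin n),
        Function.Injective re ∧ Function.Injective ce ∧
        ((A.submatrix re ce).det).natAbs = Δ) →
      Δ ≤ 2 ^ matrixOCP A * maxEntry A ^ k) := by
  subst hk
  refine ⟨fun h => ⟨fun i j => ?_, part_two hrow h, part_three h⟩, ?_⟩
  · have := h 1 (fun _ => i) (fun _ => j) (fun _ _ _ => Subsingleton.elim _ _)
      (fun _ _ _ => Subsingleton.elim _ _)
    simpa [Matrix.det_unique] using this
  · rintro ⟨-, r, re, ce, -, hce, rfl⟩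
    exact part_four A hrow r re ce hce
end

section
/- Let B be the edge-vertex incidence matrix of a graph H and let w ∈ ℝ^{V(H)}. If the linear program max{wᵀx : Bx ≤ 𝟏} attains its maximum at the all-halves vector (1/2)·𝟏, then the integer program max{wᵀx : Bx ≤ 𝟏, x ∈ ℤ^{V(H)}} attains its maximum at a point of {0, 1}^{V(H)}. -/
/-- Let `H` be a graph with edge-vertex incidence matrix `B`
(so `Bx ≤ 𝟏` reads `x u + x v ≤ 1` for every edge `uv` of `H`) and let
`w ∈ ℝ^{V(H)}`.  If the linear program `max {wᵀx : Bx ≤ 𝟏}` attains its maximum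
at the all-halves vector `(1/2)·𝟏`, then the integer program
`max {wᵀx : Bx ≤ 𝟏, x ∈ ℤ^{V(H)}}` attains its maximum at a point of
`{0, 1}^{V(H)}`. -/
theorem integer_program_optimum_zero_one (V : Type) [Fintype V]
    (H : SimpleGraph V) (w : V → ℝ)
    (hopt : ∀ x : V → ℝ, (∀ u v : V, H.Adj u v → x u + x v ≤ 1) →
      ∑ v, w v * x v ≤ ∑ v, w v * (1 / 2 : ℝ)) :
    ∃ x : V → ℝ, (∀ v, x v = 0 ∨ x v = 1) ∧
      (∀ u v : V, H.Adj u v → x u + x v ≤ 1) ∧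
      ∀ y : V → ℝ, (∀ v, ∃ z : ℤ, y v = (z : ℝ)) →
        (∀ u v : V, H.Adj u v → y u + y v ≤ 1) →
        ∑ v, w v * y v ≤ ∑ v, w v * x v := by
  classical
  let F : Type := {f : V → Bool // ∀ u v : V, H.Adj u v → ¬ (f u = true ∧ f v = true)}
  let X : F → V → ℝ := fun f v => if f.1 v = true then 1 else 0
  have : Nonempty F := ⟨⟨fun _ => false, by simp⟩⟩
  obtain ⟨f, hf⟩ := Finite.exists_max (fun f : F => ∑ v, w v * X f v)
  refine ⟨X f, ?_, ?_, ?_⟩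
  · intro v
    simp only [X]
    split_ifs <;> simp
  · intro u v huv
    have h := f.2 u v huv
    simp only [X]
    split_ifs with h1 h2 h2
    · exact absurd ⟨h1, h2⟩ h
    all_goals norm_num
  · intro y hy hfeas
    choose z hz using hy
    have hfz : ∀ u v : V, H.Adj u v → z u + z v ≤ 1 := by
      intro u v huv
      have h := hfeas u v huv
      rw [hz, hz] at h
      exact_mod_cast h
    let g : F := ⟨fun v => decide (1 ≤ z v), by
      intro u v huv
      have h := hfz u v huv
      simp only [decide_eq_true_eq]
      omega⟩
    have hX : ∀ v, X g v = ((if 1 ≤ z v then 1 else 0 : ℤ) : ℝ) := by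
      intro v
      simp [X, g]
    have h := hopt (fun v => 1 / 2 + (y v - X g v)) (by
      intro u v huv
      have h := hfz u v huv
      have key : (z u - (if 1 ≤ z u then 1 else 0)) + (z v - (if 1 ≤ z v then 1 else 0)) ≤ 0 := by
        split_ifs <;> omega
      have key' : (y u - X g u) + (y v - X g v) ≤ 0 := by
        rw [hX, hX, hz, hz]
        exact_mod_cast key
      linarith)
    have h2 := hf g
    simp only [mul_add, mul_sub, Finset.sum_add_distrib, Finset.sum_sub_distrib] at h
    linarith
end
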